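/- arXiv:1611.08892 — 5 statements merged into one kernel-verified Lean document; each statement's English description precedes it below -/
import Mathlib

section
/- Let A be an input for the team power game, B a strategy profile for A, S a nonempty coalition of teams, and k a fixed time slot; write p := ∑_{i ∉ S} B i k and, for j ≠ k, q_j := ∑_{i ∉ S} B i j. Then S has an improvement step D with respect to B satisfying D i j = 0 for all i ∈ S and all j ≠ k if and only if there exist natural numbers x_i (for i ∈ S) such that: (1) 1 ≤ x_i ≤ A i k for every i ∈ S; (2) x_i / (p + ∑_{i' ∈ S} x_{i'}) is strictly greater than the pay-off of team i under B, for every i ∈ S; and (3) p + ∑_{i' ∈ S} x_{i'} > q_j for every time slot j ≠ k (so that k becomes the unique winner). -/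
open Finset

section TPG

variable {T C : Type*} [Fintype T] [Fintype C] [DecidableEq T] [DecidableEq C]

/-- Sum of declared availabilities at a time slot. -/
def colSum (B : T → C → ℕ) (j : C) : ℕ := ∑ i, B i j

/-- Winning time slots: those maximizing the column sum. -/
def winners (B : T → C → ℕ) : Finset C :=
  Finset.univ.filter fun j => ∀ j', colSum B j' ≤ colSum B j

/-- Relative power of team `i` at slot `j` (0 when the denominator is 0). -/
def power (B : T → C → ℕ) (i : T) (j : C) : ℚ :=
  (B i j : ℚ) / (colSum B j : ℚ)

/-- Pay-off of team `i`: minimum relative power over all winning slots. -/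
def payoff (B : T → C → ℕ) (i : T) : ℚ :=
  if h : (winners B).Nonempty then (winners B).inf' h (power B i) else 0

/-- `B` is a strategy profile for input `A`. -/
def IsProfile (A B : T → C → ℕ) : Prop := ∀ i j, B i j ≤ A i j

/-- `D` is an improvement step for coalition `S` with respect to `B` (for input `A`). -/
def IsImprovement (A B : T → C → ℕ) (S : Finset T) (D : T → C → ℕ) : Prop :=
  IsProfile A D ∧ (∀ i ∉ S, ∀ j, D i j = B i j) ∧ ∀ i ∈ S, payoff B i < payoff D i

/-- `B` is a `t`-strong Nash equilibrium for `A`. -/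
def IsStrongNash (t : ℕ) (A B : T → C → ℕ) : Prop :=
  IsProfile A B ∧
    ∀ S : Finset T, S.Nonempty → S.card ≤ t → ∀ D, ¬ IsImprovement A B S D

end TPG

section TPG

variable {T C : Type*} [Fintype T]

theorem colSum_eq_sum_compl_add_sum [DecidableEq T] {B D : T → C → ℕ} {S : Finset T}
    (h : ∀ i ∉ S, ∀ j, D i j = B i j) (j : C) :
    colSum D j = ∑ i ∈ Sᶜ, B i j + ∑ i ∈ S, D i j := by
  rw [colSum, ← Finset.sum_compl_add_sum S]
  congr 1
  exact Finset.sum_congr rfl fun i hi => h i (Finset.mem_compl.mp hi) j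

variable [Fintype C]

theorem winners_nonempty [Nonempty C] (B : T → C → ℕ) : (winners B).Nonempty := by
  obtain ⟨j, -, hj⟩ := Finset.exists_max_image Finset.univ (colSum B) Finset.univ_nonempty
  exact ⟨j, by simpa [winners] using hj⟩

theorem payoff_nonneg (B : T → C → ℕ) (i : T) : 0 ≤ payoff B i := by
  unfold payoff
  split_ifs with h
  · exact Finset.le_inf' h _ fun j _ => by unfold power; positivity
  · exact le_rfl

theorem payoff_le_power {B : T → C → ℕ} {j : C} (hj : j ∈ winners B) (i : T) :
    payoff B i ≤ power B i j := by
  rw [payoff, dif_pos ⟨j, hj⟩]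
  exact Finset.inf'_le _ hj

theorem winners_eq_singleton_iff {B : T → C → ℕ} {k : C} :
    winners B = {k} ↔ ∀ j, j ≠ k → colSum B j < colSum B k := by
  constructor
  · intro h j hj
    have hk : k ∈ winners B := by simp [h]
    have hjw : j ∉ winners B := by simpa [h] using hj
    simp only [winners, Finset.mem_filter, Finset.mem_univ, true_and, not_forall, not_le]
      at hk hjw
    obtain ⟨j', hj'⟩ := hjw
    exact hj'.trans_le (hk j')
  · intro h
    ext j
    simp only [winners, Finset.mem_filter, Finset.mem_univ, true_and, Finset.mem_singleton]
    constructor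
    · intro hj
      by_contra hne
      exact (h j hne).not_ge (hj k)
    · rintro rfl j'
      rcases eq_or_ne j' j with rfl | hne
      · exact le_rfl
      · exact (h j' hne).le

theorem payoff_eq_power {B : T → C → ℕ} {k : C} (h : winners B = {k}) (i : T) :
    payoff B i = power B i k := by
  simp [payoff, h]

theorem winners_eq_singleton_of_payoff_pos {B : T → C → ℕ} {i : T} {k : C}
    (hpos : 0 < payoff B i) (hB : ∀ j, j ≠ k → B i j = 0) : winners B = {k} := by
  have : Nonempty C := ⟨k⟩
  refine (winners_nonempty B).subset_singleton_iff.mp fun j hj => ?_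
  by_contra hne
  have hle := payoff_le_power hj i
  rw [power, hB j (by simpa using hne)] at hle
  simp only [Nat.cast_zero, zero_div] at hle
  exact hle.not_gt hpos

end TPG

/-- A coalition `S` has an improvement step with respect to `B` involving only the
time slot `k` if and only if the corresponding threshold-covering system has a
solution: natural numbers `x i` (for `i ∈ S`) with `1 ≤ x i ≤ A i k`, whose resulting
relative powers at `k` beat the old pay-offs, and which make `k` the unique winner. -/
theorem improvement_step_iff_threshold_covering {n m : ℕ}
    (A B : Fin n → Fin m → ℕ) (hB : IsProfile A B)
    (S : Finset (Fin n)) (hS : S.Nonempty) (k : Fin m) :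
    (∃ D : Fin n → Fin m → ℕ,
        IsImprovement A B S D ∧ ∀ i ∈ S, ∀ j, j ≠ k → D i j = 0) ↔
    (∃ x : Fin n → ℕ,
        (∀ i ∈ S, 1 ≤ x i ∧ x i ≤ A i k) ∧
        (∀ i ∈ S,
          payoff B i <
            (x i : ℚ) / ((((∑ i' ∈ Sᶜ, B i' k) + ∑ i' ∈ S, x i' : ℕ) : ℚ))) ∧
        (∀ j, j ≠ k →
          ∑ i' ∈ Sᶜ, B i' j < (∑ i' ∈ Sᶜ, B i' k) + ∑ i' ∈ S, x i')) := by
  constructor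
  · rintro ⟨D, ⟨hDA, hDB, himp⟩, hD⟩
    have hpos : ∀ i ∈ S, 0 < payoff D i := fun i hi => (payoff_nonneg B i).trans_lt (himp i hi)
    have hwin : winners D = {k} := by
      obtain ⟨i, hi⟩ := hS
      exact winners_eq_singleton_of_payoff_pos (hpos i hi) (hD i hi)
    refine ⟨fun i => D i k, fun i hi => ⟨?_, hDA i k⟩, fun i hi => ?_, fun j hj => ?_⟩
    · have h := hpos i hi
      rw [payoff_eq_power hwin, power] at h
      refine Nat.one_le_iff_ne_zero.mpr fun h0 => ?_
      simp [h0] at h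
    · rw [← colSum_eq_sum_compl_add_sum hDB k]
      exact (himp i hi).trans_eq (payoff_eq_power hwin i)
    · have h := winners_eq_singleton_iff.mp hwin j hj
      rw [colSum_eq_sum_compl_add_sum hDB, colSum_eq_sum_compl_add_sum hDB] at h
      exact (Nat.le_add_right _ _).trans_lt h
  · rintro ⟨x, hx, hpay, hcover⟩
    let D : Fin n → Fin m → ℕ := fun i j => if i ∈ S then (if j = k then x i else 0) else B i j
    have hDB : ∀ i ∉ S, ∀ j, D i j = B i j := fun i hi j => by simp [D, hi]
    have hDk : ∀ i ∈ S, D i k = x i := fun i hi => by simp [D, hi]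
    have hD : ∀ i ∈ S, ∀ j, j ≠ k → D i j = 0 := fun i hi j hj => by simp [D, hi, hj]
    have hsum : colSum D k = ∑ i ∈ Sᶜ, B i k + ∑ i ∈ S, x i := by
      rw [colSum_eq_sum_compl_add_sum hDB, Finset.sum_congr rfl hDk]
    have hwin : winners D = {k} := winners_eq_singleton_iff.mpr fun j hj => by
      rw [hsum, colSum_eq_sum_compl_add_sum hDB,
        Finset.sum_eq_zero fun i hi => hD i hi j hj, add_zero]
      exact hcover j hj
    refine ⟨D, ⟨fun i j => ?_, hDB, fun i hi => ?_⟩, hD⟩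
    · by_cases hi : i ∈ S
      · rcases eq_or_ne j k with rfl | hj
        · exact (hDk i hi).trans_le (hx i hi).2
        · exact (hD i hi j hj).trans_le (Nat.zero_le _)
      · exact (hDB i hi j).trans_le (hB i j)
    · rw [payoff_eq_power hwin, power, hDk i hi, hsum]
      exact hpay i hi
end

section
/- (Correctness of the guess-the-sum algorithm for t-Threshold Covering.) Let t ≥ 1, let a_1,…,a_t ∈ ℕ, let p ∈ ℕ, and let p_1,…,p_t ∈ ℚ with p_i ≥ 0 for all i. Then there exists a vector (x_1,…,x_t) of natural numbers with 1 ≤ x_i ≤ a_i and x_i / (p + ∑_{i'=1}^t x_{i'}) > p_i for every i ∈ [t], if and only if there exists a natural number w ≤ ∑_{i=1}^t a_i such that for every i ∈ [t] the set M_i(w) := { x ∈ ℕ : 1 ≤ x ≤ a_i and x / (p + w) > p_i } is nonempty, and ∑_{i=1}^t min M_i(w) ≤ w. -/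
open Finset

/-- Correctness of the guess-the-sum algorithm for `t`-Threshold Covering:
a solution `(x_1,…,x_t)` with `1 ≤ x i ≤ a i` and `x i / (p + ∑ x) > p i` exists
iff there is a guess `w ≤ ∑ a i` such that every set
`M i w = {x | 1 ≤ x ≤ a i ∧ x/(p+w) > p i}` is nonempty and the sum of their minima
is at most `w`. -/
theorem threshold_covering_guess_sum (t : ℕ) (ht : 1 ≤ t) (a : Fin t → ℕ) (p : ℕ)
    (pr : Fin t → ℚ) (hpr : ∀ i, 0 ≤ pr i) :
    (∃ x : Fin t → ℕ,
        ∀ i, (1 ≤ x i ∧ x i ≤ a i) ∧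
          pr i < (x i : ℚ) / (((p + ∑ i', x i' : ℕ) : ℚ))) ↔
    (∃ w ≤ ∑ i, a i,
        (∀ i, {x : ℕ | 1 ≤ x ∧ x ≤ a i ∧ pr i < (x : ℚ) / (((p + w : ℕ) : ℚ))}.Nonempty) ∧
        ∑ i, sInf {x : ℕ | 1 ≤ x ∧ x ≤ a i ∧ pr i < (x : ℚ) / (((p + w : ℕ) : ℚ))} ≤ w) := by
  constructor
  · rintro ⟨x, hx⟩
    refine ⟨∑ i, x i, sum_le_sum fun i _ => (hx i).1.2,
      fun i => ⟨x i, (hx i).1.1, (hx i).1.2, (hx i).2⟩, ?_⟩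
    exact sum_le_sum fun i _ => Nat.sInf_le ⟨(hx i).1.1, (hx i).1.2, (hx i).2⟩
  · rintro ⟨w, -, hne, hsum⟩
    have hmem := fun i => Nat.sInf_mem (hne i)
    refine ⟨_, fun i => ⟨⟨(hmem i).1, (hmem i).2.1⟩, (hmem i).2.2.trans_le ?_⟩⟩
    have hpos := (hmem i).1.trans <| single_le_sum
      (f := fun i => sInf {x : ℕ | 1 ≤ x ∧ x ≤ a i ∧ pr i < (x : ℚ) / (((p + w : ℕ) : ℚ))})
      (fun _ _ => Nat.zero_le _) (mem_univ i)
    refine div_le_div_of_nonneg_left (Nat.cast_nonneg _) (Nat.cast_pos.2 ?_) (Nat.cast_le.2 ?_)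
    · exact Nat.add_pos_right p hpos
    · exact Nat.add_le_add_left hsum p
end

section
/- (Safe single-team slot.) Let A be an input for the team power game with n teams and m time slots. Suppose there exist a time slot j* and a team i* such that A i* j* > 0, A i j* = 0 for every team i ≠ i*, and A i j ≤ A i* j* for every team i ≠ i* and every time slot j. Then the strategy profile B defined by B i* j* = A i* j* and B i j = 0 for all other entries is a 1-strong Nash equilibrium for A; in particular, A admits a 1-strong Nash equilibrium. -/
open Finset

section TPG

variable {T C : Type*} [Fintype T]

theorem power_nonneg (B : T → C → ℕ) (i : T) (j : C) : 0 ≤ power B i j := by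
  unfold power
  positivity

theorem power_le_one (B : T → C → ℕ) (i : T) (j : C) : power B i j ≤ 1 := by
  refine div_le_one_of_le₀ ?_ (Nat.cast_nonneg _)
  exact_mod_cast Finset.single_le_sum (f := fun i => B i j) (fun _ _ => Nat.zero_le _)
    (Finset.mem_univ i)

theorem colSum_single_entry [DecidableEq T] [DecidableEq C] (a : ℕ)
    (i₀ : T) (j₀ j : C) :
    colSum (fun i j => if i = i₀ ∧ j = j₀ then a else 0) j = if j = j₀ then a else 0 := by
  by_cases hj : j = j₀ <;> simp [colSum, hj]

variable [Fintype C]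

theorem mem_winners {B : T → C → ℕ} {j : C} :
    j ∈ winners B ↔ ∀ j', colSum B j' ≤ colSum B j := by
  simp [winners]

theorem payoff_le_one (B : T → C → ℕ) (i : T) : payoff B i ≤ 1 := by
  by_cases h : (winners B).Nonempty
  · obtain ⟨j, hj⟩ := h
    exact (payoff_le_power hj i).trans (power_le_one B i j)
  · simp [payoff, h]

variable [DecidableEq T] [DecidableEq C]

theorem payoff_single_entry {a : ℕ} (ha : 0 < a) (i₀ : T) (j₀ : C) :
    payoff (fun i j => if i = i₀ ∧ j = j₀ then a else 0) i₀ = 1 := by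
  have hw : winners (fun (i : T) (j : C) => if i = i₀ ∧ j = j₀ then a else 0) = {j₀} := by
    ext j
    simp only [mem_winners, colSum_single_entry, Finset.mem_singleton]
    refine ⟨fun h => ?_, fun h j' => ?_⟩
    · by_contra hj
      have := h j₀
      simp [hj] at this
      omega
    · simp only [h, if_true]
      split_ifs <;> omega
  have ha' : (a : ℚ) ≠ 0 := by exact_mod_cast ha.ne'
  simp [payoff, hw, power, colSum_single_entry, ha']

/-- A team that is unavailable at the only declared slot, and whose availabilities do not exceed
the declared one, gains nothing by deviating alone. -/
theorem payoff_eq_zero_of_deviation {D : T → C → ℕ} {a : ℕ} {i i₀ : T} {j₀ : C} (hi : i ≠ i₀)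
    (hD : ∀ k, k ≠ i → ∀ j, D k j = if k = i₀ ∧ j = j₀ then a else 0)
    (hzero : D i j₀ = 0) (hle : ∀ j, D i j ≤ a) : payoff D i = 0 := by
  have hsum (j : C) : colSum D j = D i j + if j = j₀ then a else 0 := by
    rw [← colSum_single_entry a i₀ j₀ j, colSum, colSum,
      ← Finset.add_sum_erase _ _ (Finset.mem_univ i),
      ← Finset.add_sum_erase Finset.univ
        (fun k => if k = i₀ ∧ j = j₀ then a else 0) (Finset.mem_univ i)]
    simp only [hi, false_and, if_false, zero_add]
    congr 1
    exact Finset.sum_congr rfl fun k hk => hD k (Finset.ne_of_mem_erase hk) j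
  have hwin : j₀ ∈ winners D := by
    rw [mem_winners]
    intro j
    by_cases hj : j = j₀
    · rw [hj]
    · simpa [hsum, hj, hzero] using hle j
  refine le_antisymm ((payoff_le_power hwin i).trans ?_) (payoff_nonneg D i)
  simp [power, hzero]

end TPG

/-- Safe single-team slot: if at slot `j*` only team `i*` is available (with positive
availability) and no other team has an availability exceeding `A i* j*` anywhere, then
declaring `A i* j*` at `(i*, j*)` and zero everywhere else is a 1-strong Nash
equilibrium; in particular `A` admits a 1-strong Nash equilibrium. -/
theorem safe_single_team_slot {n m : ℕ} (A : Fin n → Fin m → ℕ)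
    (istar : Fin n) (jstar : Fin m)
    (hpos : 0 < A istar jstar)
    (honly : ∀ i, i ≠ istar → A i jstar = 0)
    (hmax : ∀ i, i ≠ istar → ∀ j, A i j ≤ A istar jstar) :
    IsStrongNash 1 A (fun i j => if i = istar ∧ j = jstar then A istar jstar else 0) ∧
    ∃ B : Fin n → Fin m → ℕ, IsStrongNash 1 A B := by
  suffices h : IsStrongNash 1 A
      (fun i j => if i = istar ∧ j = jstar then A istar jstar else 0) from ⟨h, _, h⟩
  refine ⟨fun i j => ?_, fun S hS hcard D ⟨hprof, hfix, himp⟩ => ?_⟩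
  · dsimp only
    split_ifs with h
    · rw [h.1, h.2]
    · exact Nat.zero_le _
  obtain ⟨i, rfl⟩ := Finset.card_eq_one.1 (le_antisymm hcard hS.card_pos)
  have hlt := himp i (Finset.mem_singleton_self i)
  by_cases hi : i = istar
  · subst hi
    rw [payoff_single_entry hpos] at hlt
    exact absurd hlt (payoff_le_one D i).not_gt
  · have hzero : payoff D i = 0 :=
      payoff_eq_zero_of_deviation hi (fun k hk => hfix k (by simpa using hk))
        (Nat.le_zero.1 ((hprof i jstar).trans (honly i hi).le))
        fun j => (hprof i j).trans (hmax i hi j)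
    rw [hzero] at hlt
    exact absurd hlt (payoff_nonneg _ i).not_gt
end

section
/- Let A be an input for the team power game with n teams and m time slots such that every entry of A is at most 3 (i.e., the maximum true availability a_max satisfies a_max ≤ 3). Then A admits a 1-strong Nash equilibrium, i.e., there exists a strategy profile B for A such that no single team has an improvement step with respect to B. -/
open Finset

/-- Criterion for a profile with a unique winning slot `j`: every slot `k` that a team `i` could
turn to is either blocked by another slot or does not give `i` a larger relative power. -/
theorem isStrongNash_one_of_unique_winner {T C : Type*} [Fintype T] [Fintype C] [DecidableEq T]
    {A B : T → C → ℕ} (hB : IsProfile A B) (j : C) (hpos : 0 < colSum B j)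
    (hlt : ∀ k, k ≠ j → colSum B k < colSum B j)
    (hdev : ∀ i k, (∃ l, l ≠ k ∧ colSum B k + A i k + B i l ≤ colSum B l + B i k) ∨
      A i k * colSum B j + B i j * B i k ≤ B i j * (colSum B k + A i k)) :
    IsStrongNash 1 A B := by
  refine ⟨hB, ?_⟩
  rintro S ⟨i, hi⟩ hcard D ⟨hD, hout, himp⟩
  have hS : ∀ i', i' ≠ i → i' ∉ S := fun i' hne h' =>
    hne (Finset.card_le_one.mp hcard i' h' i hi)
  have hcol : ∀ k, colSum D k + B i k = colSum B k + D i k := by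
    intro k
    have h₁ := Finset.add_sum_erase univ (fun i' => D i' k) (mem_univ i)
    have h₂ := Finset.add_sum_erase univ (fun i' => B i' k) (mem_univ i)
    have h₃ : ∑ i' ∈ univ.erase i, D i' k = ∑ i' ∈ univ.erase i, B i' k :=
      Finset.sum_congr rfl fun i' h' => hout i' (hS i' (Finset.ne_of_mem_erase h')) k
    simp only [colSum]
    omega
  have hBle : ∀ k, B i k ≤ colSum B k := fun k =>
    Finset.single_le_sum (f := fun i' => B i' k) (fun _ _ => Nat.zero_le _) (mem_univ i)
  have hpayB : payoff B i = power B i j := by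
    have hw : winners B = {j} := by
      ext k
      simp only [winners, mem_filter, mem_univ, true_and, mem_singleton]
      constructor
      · intro h
        by_contra hne
        exact absurd (h j) (not_le.mpr (hlt k hne))
      · rintro rfl k'
        by_cases h : k' = k
        · rw [h]
        · exact (hlt k' h).le
    simp [payoff, hw]
  have hDle : ∀ k ∈ winners D, payoff D i ≤ power D i k := by
    intro k hk
    have hne : (winners D).Nonempty := ⟨k, hk⟩
    rw [payoff, dif_pos hne]
    exact Finset.inf'_le _ hk
  have hlow := himp i hi
  rw [hpayB] at hlow
  have hnonneg : 0 ≤ power B i j := by unfold power; positivity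
  obtain ⟨k, -, hk⟩ := Finset.exists_max_image univ (colSum D) ⟨j, mem_univ j⟩
  have hkw : k ∈ winners D := by simpa [winners] using hk
  rcases hdev i k with ⟨l, -, hl⟩ | hpay
  · have hck := hcol k
    have hcl := hcol l
    have hDk := hD i k
    have hkl := hk l (mem_univ l)
    have hDl : D i l = 0 := by omega
    have hlw : l ∈ winners D := by
      simp only [winners, mem_filter, mem_univ, true_and]
      intro k'
      have := hk k' (mem_univ k')
      omega
    have h := hDle l hlw
    simp only [power, hDl, Nat.cast_zero, zero_div] at h
    linarith
  · have h := lt_of_lt_of_le hlow (hDle k hkw)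
    have hck := hcol k
    have hDk := hD i k
    obtain ⟨s, hs⟩ := Nat.exists_eq_add_of_le (hBle k)
    obtain ⟨r, hr⟩ := Nat.exists_eq_add_of_le (hBle j)
    have hkD : colSum D k = s + D i k := by omega
    have hAr : A i k * r ≤ B i j * s := by
      rw [hs, hr] at hpay
      nlinarith
    have hDr : D i k * r ≤ B i j * s := (Nat.mul_le_mul_right r hDk).trans hAr
    have hle : D i k * colSum B j ≤ B i j * colSum D k := by
      rw [hkD, hr]
      nlinarith
    refine absurd h (not_lt.mpr ?_)
    unfold power
    rcases Nat.eq_zero_or_pos (colSum D k) with h0 | h0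
    · simp only [h0, Nat.cast_zero, div_zero]
      positivity
    · rw [div_le_div_iff₀ (by exact_mod_cast h0) (by exact_mod_cast hpos)]
      exact_mod_cast hle

/-- The equilibrium criterion for the profile in which slot `j` gets all true availabilities and
the other slots get `w`. -/
theorem exists_isStrongNash_one_of_full_column {T C : Type*} [Fintype T] [Fintype C]
    [DecidableEq T] [DecidableEq C] {A : T → C → ℕ} (w : T → C → ℕ) (hw : IsProfile A w) (j : C)
    (hpos : 0 < colSum A j) (hlt : ∀ k, k ≠ j → colSum w k < colSum A j)
    (hdev : ∀ i k, k ≠ j → colSum w k + A i k + A i j ≤ colSum A j + w i k ∨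
      (∃ l, l ≠ k ∧ l ≠ j ∧ colSum w k + A i k + w i l ≤ colSum w l + w i k) ∨
      A i k * colSum A j + A i j * w i k ≤ A i j * (colSum w k + A i k)) :
    ∃ B, IsStrongNash 1 A B := by
  have hj : colSum (fun i => Function.update (w i) j (A i j)) j = colSum A j := by simp [colSum]
  have hk : ∀ k, k ≠ j → colSum (fun i => Function.update (w i) j (A i j)) k = colSum w k :=
    fun k h => by simp [colSum, h]
  refine ⟨fun i => Function.update (w i) j (A i j),
    isStrongNash_one_of_unique_winner ?_ j (by rwa [hj]) ?_ ?_⟩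
  · intro i k
    by_cases h : k = j
    · subst h; simp
    · simpa [h] using hw i k
  · intro k h
    rw [hj, hk k h]
    exact hlt k h
  · intro i k
    by_cases h : k = j
    · subst h
      right
      rw [hj]
      simp only [Function.update_self]
      exact (by ring : A i k * colSum A k + A i k * A i k = A i k * (colSum A k + A i k)).le
    · rcases hdev i k h with h' | ⟨l, hlk, hlj, h'⟩ | h'
      · left
        refine ⟨j, fun e => h e.symm, ?_⟩
        rw [hj, hk k h]
        simpa [h] using h'
      · left
        refine ⟨l, hlk, ?_⟩
        rw [hk l hlj, hk k h]
        simpa [h, hlj] using h'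
      · right
        rw [hj, hk k h]
        simpa [h] using h'

theorem exists_isStrongNash_one_of_single_column {T C : Type*} [Fintype T] [Fintype C]
    [DecidableEq T] [DecidableEq C] {A : T → C → ℕ} (j : C) (hpos : 0 < colSum A j)
    (h : ∀ i k, A i k + A i j ≤ colSum A j ∨ A i j = colSum A j) :
    ∃ B, IsStrongNash 1 A B := by
  have h0 : ∀ k, colSum (fun (_ : T) (_ : C) => 0) k = 0 := fun k => by simp [colSum]
  refine exists_isStrongNash_one_of_full_column (fun _ _ => 0) (fun _ _ => Nat.zero_le _) j hpos
    (fun k _ => by rwa [h0]) fun i k _ => ?_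
  rw [h0]
  rcases h i k with h' | h'
  · left; omega
  · right; right
    rw [h']
    nlinarith

theorem entry_add_entry_le_colSum {T C : Type*} [Fintype T] [DecidableEq T] (A : T → C → ℕ)
    {i i' : T} (h : i ≠ i') (k : C) : A i k + A i' k ≤ colSum A k := by
  have h₁ := Finset.add_sum_erase univ (fun x => A x k) (mem_univ i)
  have h₂ : A i' k ≤ ∑ x ∈ univ.erase i, A x k :=
    Finset.single_le_sum (f := fun x => A x k) (fun _ _ => Nat.zero_le _)
      (Finset.mem_erase.mpr ⟨h.symm, mem_univ i'⟩)
  unfold colSum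
  omega

theorem entry_add_sum_ite_eq_colSum {T C : Type*} [Fintype T] [DecidableEq T] (A : T → C → ℕ)
    (a : T) (k : C) : A a k + ∑ i, (if i = a then 0 else A i k) = colSum A k := by
  have h : ∀ i, A i k = (if i = a then A a k else 0) + if i = a then 0 else A i k := by
    intro i
    split_ifs with e <;> simp [e]
  rw [colSum, Finset.sum_congr rfl fun i _ => h i, Finset.sum_add_distrib]
  simp

/-- If the maximum true availability is at most three, then the team power game
always admits a 1-strong Nash equilibrium. -/
theorem one_strong_nash_exists_of_amax_le_three {n m : ℕ} (A : Fin n → Fin m → ℕ)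
    (hmax : ∀ i j, A i j ≤ 3) :
    ∃ B : Fin n → Fin m → ℕ, IsStrongNash 1 A B := by
  classical
  have hle : ∀ i k, A i k ≤ colSum A k := fun i k =>
    Finset.single_le_sum (f := fun i' => A i' k) (fun _ _ => Nat.zero_le _) (mem_univ i)
  by_cases hzero : ∀ i j, A i j = 0
  · refine ⟨A, fun _ _ => le_rfl, ?_⟩
    rintro S ⟨i, hi⟩ - D ⟨hD, -, himp⟩
    have hDA : D = A := by
      funext i k
      have := hD i k
      rw [hzero i k] at this ⊢
      omega
    exact lt_irrefl _ (hDA ▸ himp i hi)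
  push Not at hzero
  obtain ⟨i₀, j₀, h₀⟩ := hzero
  obtain ⟨⟨a₀, c₀⟩, -, hbig⟩ := Finset.exists_max_image univ
    (fun x : Fin n × Fin m => A x.1 x.2) ⟨(i₀, j₀), mem_univ _⟩
  obtain ⟨p, hp⟩ : ∃ p, p = A a₀ c₀ := ⟨_, rfl⟩
  have hAp : ∀ i k, A i k ≤ p := fun i k => hp ▸ hbig (i, k) (mem_univ _)
  have hp3 : p ≤ 3 := hp ▸ hmax a₀ c₀
  have hp0 : 0 < p := lt_of_lt_of_le (Nat.pos_of_ne_zero h₀) (hAp i₀ j₀)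
  by_cases hlarge : ∃ k, 2 * p ≤ colSum A k
  · obtain ⟨k, hk⟩ := hlarge
    refine exists_isStrongNash_one_of_single_column k (by omega) fun i l => Or.inl ?_
    have h₁ := hAp i l
    have h₂ := hAp i k
    omega
  push Not at hlarge
  obtain ⟨⟨a, j⟩, haj, hmin⟩ := Finset.exists_min_image
    (univ.filter fun x : Fin n × Fin m => A x.1 x.2 = p) (fun x => colSum A x.2)
    ⟨(a₀, c₀), by simp [hp]⟩
  simp only [mem_filter, mem_univ, true_and] at haj hmin
  have hmin' : ∀ k, A a k = p → colSum A j ≤ colSum A k := fun k hk => hmin (a, k) hk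
  obtain ⟨o, ho⟩ := Nat.exists_eq_add_of_le (hle a j)
  rw [haj] at ho
  have hjo : ∀ i, i ≠ a → A i j ≤ o := fun i hi => by
    have := entry_add_entry_le_colSum A hi j
    omega
  rcases Nat.eq_zero_or_pos o with rfl | ho0
  · refine exists_isStrongNash_one_of_single_column j (by omega) fun i l => ?_
    by_cases hi : i = a
    · right; rw [hi]; omega
    · left
      have h₁ := hjo i hi
      have h₂ := hAp i l
      omega
  have hop : o < p := by have := hlarge j; omega
  by_cases hspec : ∃ k, A a k = 2 ∧ colSum A k = 2 ∧ p = 3 ∧ o = 1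
  · obtain ⟨k₀, hk₀, hk₀', rfl, rfl⟩ := hspec
    by_cases hother : ∃ i l, i ≠ a ∧ A i l = 3
    · obtain ⟨c, l, hca, hcl⟩ := hother
      obtain ⟨b, hba, hbj, hb⟩ : ∃ b, b ≠ a ∧ A b j = 1 ∧ ∀ i, i ≠ a → i ≠ b → A i j = 0 := by
        have hsum := entry_add_sum_ite_eq_colSum A a j
        obtain ⟨b, -, hb⟩ : ∃ b ∈ univ, (if b = a then 0 else A b j) ≠ 0 :=
          Finset.exists_ne_zero_of_sum_ne_zero (by omega)
        have hba : b ≠ a := by rintro rfl; simp at hb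
        rw [if_neg hba] at hb
        have h₁ := hjo b hba
        refine ⟨b, hba, by omega, fun i hia hib => ?_⟩
        have h₂ : (if b = a then 0 else A b j) + (if i = a then 0 else A i j) ≤
            ∑ i, (if i = a then 0 else A i j) := by
          have := entry_add_entry_le_colSum (fun i k => if i = a then 0 else A i k) hib.symm j
          simpa [colSum] using this
        rw [if_neg hba, if_neg hia] at h₂
        omega
      have hAc : ∀ i, i ≠ c → A i l ≤ 2 := fun i hi => by
        have h₁ := entry_add_entry_le_colSum A hi l
        have h₂ := hlarge l
        omega
      obtain ⟨v, hva, hvA, hvsum, hvb, hv⟩ : ∃ v : Fin n → ℕ, v a = 0 ∧ (∀ i, v i ≤ A i l) ∧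
          ∑ i, v i = 2 ∧ A b l ≤ v b + 1 ∧ ∀ i, A i l ≤ v i + 2 := by
        by_cases hbl : A b l = 2
        · have hbc : b ≠ c := by rintro rfl; omega
          refine ⟨fun i => (if i = c then 1 else 0) + if i = b then 1 else 0, ?_, ?_, ?_, ?_, ?_⟩
          · simp [hca.symm, hba.symm]
          · intro i
            by_cases h₁ : i = c
            · subst h₁; simp [hbc.symm]; omega
            · by_cases h₂ : i = b
              · subst h₂; simp [h₁]; omega
              · simp [h₁, h₂]
          · simp [Finset.sum_add_distrib]
          · simp [hbc]; omega
          · intro i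
            by_cases h₁ : i = c
            · subst h₁; simp [hbc.symm]; omega
            · have := hAc i h₁
              omega
        · refine ⟨fun i => if i = c then 2 else 0, ?_, ?_, ?_, ?_, ?_⟩
          · simp [hca.symm]
          · intro i
            by_cases h₁ : i = c
            · simp [h₁]; omega
            · simp [h₁]
          · simp
          · by_cases h₁ : b = c
            · simp [h₁]; omega
            · have := hAc b h₁
              simp only [h₁, if_false]
              omega
          · intro i
            by_cases h₁ : i = c
            · simp [h₁]; omega
            · have := hAc i h₁
              omega
      have hal : A a l ≠ 3 := by have := hAc a hca.symm; omega
      have hlj : l ≠ j := by rintro rfl; exact hal haj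
      obtain ⟨w, hwdef⟩ : ∃ w : Fin n → Fin m → ℕ, w = fun i k =>
        if A a k = 3 then (if i = a then 0 else A i k) else if k = l then v i else 0 := ⟨_, rfl⟩
      have hw3 : ∀ k, A a k = 3 → A a k + colSum w k = colSum A k := fun k hk => by
        rw [← entry_add_sum_ite_eq_colSum A a k]
        simp [colSum, hwdef, hk]
      have hwl : colSum w l = 2 := by simp [colSum, hwdef, hal, hvsum]
      have hw0 : ∀ k, A a k ≠ 3 → k ≠ l → colSum w k = 0 := fun k h₁ h₂ => by
        simp [colSum, hwdef, h₁, h₂]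
      have hwa : ∀ k, w a k = 0 := fun k => by simp [hwdef, hva]
      have hwA : ∀ i k, i ≠ a → A a k = 3 → w i k = A i k := fun i k h₁ h₂ => by
        simp [hwdef, h₁, h₂]
      have hwv : ∀ i, w i l = v i := fun i => by simp [hwdef, hal]
      refine exists_isStrongNash_one_of_full_column w ?_ j (by omega) ?_ ?_
      · intro i k
        simp only [hwdef]
        split_ifs with h₁ h₂ h₃
        · exact Nat.zero_le _
        · exact le_rfl
        · exact h₃ ▸ hvA i
        · exact Nat.zero_le _
      · intro k hkj
        by_cases h₁ : A a k = 3
        · have h₂ := hw3 k h₁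
          have h₃ := hlarge k
          omega
        · by_cases h₂ : k = l
          · rw [h₂, hwl]; omega
          · rw [hw0 k h₁ h₂]; omega
      · intro i k hkj
        by_cases hi : i = a
        · subst hi
          rw [hwa, haj, ho]
          by_cases h₁ : A i k = 3
          · right; right
            have h₂ := hw3 k h₁
            have h₃ := hmin' k h₁
            omega
          · have h₂ := hAp i k
            by_cases h₃ : k = l
            · right; right
              subst h₃
              rw [hwl]
              omega
            · right; left
              refine ⟨l, fun e => h₃ e.symm, hlj, ?_⟩
              rw [hwa, hwl, hw0 k h₁ h₃]
              omega
        · left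
          have h₀ := hjo i hi
          have h₂ := hAp i k
          by_cases h₁ : A a k = 3
          · have h₃ := hw3 k h₁
            have h₄ := hlarge k
            rw [hwA i k hi h₁]
            omega
          · by_cases h₃ : k = l
            · subst h₃
              rw [hwl, hwv]
              have h₄ := hv i
              by_cases hib : i = b
              · subst hib; omega
              · have := hb i hi hib
                omega
            · rw [hw0 k h₁ h₃]
              omega
    · push Not at hother
      refine exists_isStrongNash_one_of_single_column k₀ (by omega) fun i l => ?_
      by_cases hi : i = a
      · right; rw [hi]; omega
      · left
        have h₁ := entry_add_entry_le_colSum A hi k₀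
        have h₂ := hother i l hi
        have h₃ := hAp i l
        omega
  · obtain ⟨w, hwdef⟩ : ∃ w : Fin n → Fin m → ℕ, w = fun i k =>
      if o < A a k then (if i = a then 0 else A i k) else 0 := ⟨_, rfl⟩
    have hw₁ : ∀ k, o < A a k → A a k + colSum w k = colSum A k := fun k hk => by
      rw [← entry_add_sum_ite_eq_colSum A a k]
      simp [colSum, hwdef, hk]
    have hw₀ : ∀ k, ¬ o < A a k → colSum w k = 0 := fun k hk => by
      simp only [colSum, hwdef, hk, if_false, Finset.sum_const_zero]
    have hwa : ∀ k, w a k = 0 := fun k => by simp [hwdef]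
    have hwA : ∀ i k, i ≠ a → o < A a k → w i k = A i k := fun i k h₁ h₂ => by
      simp [hwdef, h₁, h₂]
    refine exists_isStrongNash_one_of_full_column w ?_ j (by omega) ?_ ?_
    · intro i k
      simp only [hwdef]
      split_ifs <;> omega
    · intro k hkj
      by_cases h₁ : o < A a k
      · have h₂ := hw₁ k h₁
        have h₃ := hlarge k
        omega
      · rw [hw₀ k h₁]; omega
    · intro i k hkj
      have h₂ := hAp i k
      by_cases hi : i = a
      · subst hi
        rw [hwa, haj]
        by_cases h₁ : o < A i k
        · right; right
          have h₃ := hw₁ k h₁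
          rcases h₂.eq_or_lt with h₄ | h₄
          · have h₅ := hmin' k h₄
            rw [h₄]
            exact Nat.mul_le_mul_left p (by omega)
          · have h₆ : A i k = 2 := by omega
            have h₇ : p = 3 := by omega
            have h₈ : o = 1 := by omega
            have h₉ : colSum A k ≠ 2 := fun e => hspec ⟨k, h₆, e, h₇, h₈⟩
            subst h₇ h₈
            rw [ho, h₆]
            omega
        · left
          rw [hw₀ k h₁]
          omega
      · left
        have h₀ := hjo i hi
        by_cases h₁ : o < A a k
        · have h₃ := hw₁ k h₁
          have h₄ := hlarge k
          rw [hwA i k hi h₁]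
          omega
        · rw [hw₀ k h₁]
          omega
end

section
/- (Correctness of the Set Cover reduction, bounded coalition size.) Let U = {u_1,…,u_N} be a finite universe, F = {S_1,…,S_M} a family of subsets of U, and k an integer with 3 ≤ k ≤ M. Assume that no union of fewer than three sets of F equals U (every set cover uses at least three sets). Construct the following team power game. Time slots: one element slot e_j for each u_j ∈ U, plus two slots α and β. Teams: one set team t_i for each S_i ∈ F with true availability 1 at α, 1 at β, and 1 at e_j for each u_j ∈ S_i (and 0 elsewhere); for each element slot e_j, exactly 2M − 1 − #(u_j) dummy teams (where #(u_j) is the number of sets of F containing u_j), each with true availability 1 at e_j and 0 elsewhere; M dummy teams with true availability 1 at α and 0 elsewhere; and 2M − 1 − k dummy teams with true availability 1 at β and 0 elsewhere. Let the strategy profile B agree with the true availabilities everywhere except that every set team declares 0 at β. Then some nonempty coalition of at most k teams has an improvement step with respect to B if and only if there exists a subfamily F' ⊆ F with |F'| ≤ k and ∪_{S ∈ F'} S = U. -/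
open Finset

section Payoff

variable {T C : Type*} [Fintype T]

theorem colSum_mono {B D : T → C → ℕ} {j : C} (h : ∀ i, D i j ≤ B i j) :
    colSum D j ≤ colSum B j :=
  Finset.sum_le_sum fun i _ => h i

/-- A coalition none of whose members is available at `j` cannot change the sum at `j`. -/
theorem colSum_eq_of_forall_mem_eq_zero {A B D : T → C → ℕ} {S : Finset T} {j : C}
    (hB : IsProfile A B) (hD : IsProfile A D) (hDB : ∀ i ∉ S, ∀ j, D i j = B i j)
    (h : ∀ i ∈ S, A i j = 0) : colSum D j = colSum B j := by
  refine Finset.sum_congr rfl fun i _ => ?_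
  by_cases hi : i ∈ S
  · have h0 := h i hi
    have hBi := hB i j
    have hDi := hD i j
    omega
  · exact hDB i hi j

variable [Fintype C]

theorem lt_power_of_lt_payoff {B : T → C → ℕ} {i : T} {q : ℚ} (h : q < payoff B i)
    {j : C} (hj : j ∈ winners B) : q < power B i j := by
  have hne : (winners B).Nonempty := ⟨j, hj⟩
  rw [payoff, dif_pos hne, Finset.lt_inf'_iff] at h
  exact h j hj

theorem payoff_eq_power_of_forall_lt {B : T → C → ℕ} {j : C}
    (h : ∀ j', j' ≠ j → colSum B j' < colSum B j) (i : T) : payoff B i = power B i j := by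
  have hw : winners B = {j} := by
    ext j'
    rw [mem_winners, Finset.mem_singleton]
    constructor
    · intro hj'
      by_contra hne
      exact (h j' hne).not_ge (hj' j)
    · rintro rfl j''
      by_cases hne : j'' = j'
      · rw [hne]
      · exact (h j'' hne).le
  simp [payoff, hw]

/-- Every member of an improving coalition is available at every new winning slot. -/
theorem IsImprovement.avail_ne_zero {A B D : T → C → ℕ} {S : Finset T}
    (h : IsImprovement A B S D) {i : T} (hi : i ∈ S) {j : C} (hj : j ∈ winners D) :
    A i j ≠ 0 := by
  intro h0
  have hpos := (payoff_nonneg B i).trans_lt (h.2.2 i hi)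
  have hpow := lt_power_of_lt_payoff hpos hj
  have hD : D i j = 0 := Nat.le_zero.1 (h0 ▸ h.1 i j)
  simp [power, hD] at hpow

end Payoff

section SetCoverReduction

/-- Number of sets of the family `F` containing element `j`. -/
def occCount (N M : ℕ) (F : Fin M → Finset (Fin N)) (j : Fin N) : ℕ :=
  (Finset.univ.filter fun i : Fin M => j ∈ F i).card

/-- Teams of the reduced game: set teams, element-slot dummies, α-dummies, β-dummies. -/
abbrev SCTeam (N M k : ℕ) (F : Fin M → Finset (Fin N)) : Type :=
  (Fin M) ⊕
    ((Σ j : Fin N, Fin (2 * M - 1 - occCount N M F j)) ⊕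
      (Fin M ⊕ Fin (2 * M - 1 - k)))

/-- Time slots of the reduced game: element slots plus `α = Sum.inr false` and
`β = Sum.inr true`. -/
abbrev SCSlot (N : ℕ) : Type := (Fin N) ⊕ Bool

/-- True availabilities of the reduced game. -/
def scA (N M k : ℕ) (F : Fin M → Finset (Fin N)) :
    SCTeam N M k F → SCSlot N → ℕ := fun t s =>
  match t, s with
  | Sum.inl i, Sum.inl j => if j ∈ F i then 1 else 0
  | Sum.inl _, Sum.inr _ => 1
  | Sum.inr (Sum.inl ⟨j, _⟩), Sum.inl j' => if j' = j then 1 else 0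
  | Sum.inr (Sum.inl _), Sum.inr _ => 0
  | Sum.inr (Sum.inr (Sum.inl _)), Sum.inr false => 1
  | Sum.inr (Sum.inr (Sum.inl _)), _ => 0
  | Sum.inr (Sum.inr (Sum.inr _)), Sum.inr true => 1
  | Sum.inr (Sum.inr (Sum.inr _)), _ => 0

/-- Declared availabilities: truthful, except that set teams declare `0` at `β`. -/
def scB (N M k : ℕ) (F : Fin M → Finset (Fin N)) :
    SCTeam N M k F → SCSlot N → ℕ := fun t s =>
  match t, s with
  | Sum.inl _, Sum.inr true => 0
  | t, s => scA N M k F t s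

section Lemmas

variable {N M k : ℕ} {F : Fin M → Finset (Fin N)}

theorem occCount_le (j : Fin N) : occCount N M F j ≤ M := by
  simpa [occCount] using Finset.card_filter_le (Finset.univ : Finset (Fin M)) (fun i => j ∈ F i)

theorem scA_le_one (t : SCTeam N M k F) (s : SCSlot N) : scA N M k F t s ≤ 1 := by
  rcases t with i | ⟨j, _⟩ | a | b <;> rcases s with j' | _ | _ <;>
    simp only [scA] <;> first | omega | (split_ifs <;> omega)

theorem isProfile_scB : IsProfile (scA N M k F) (scB N M k F) := by
  rintro (i | ⟨j, _⟩ | a | b) (j' | _ | _) <;> simp [scA, scB]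

theorem colSum_scB_elem (hM : 1 ≤ M) (j : Fin N) :
    colSum (scB N M k F) (Sum.inl j) = 2 * M - 1 := by
  have h := occCount_le (F := F) j
  have hs : colSum (scB N M k F) (Sum.inl j) =
      occCount N M F j + (2 * M - 1 - occCount N M F j) := by
    rw [colSum, Fintype.sum_sum_type, Fintype.sum_sum_type, Fintype.sum_sigma]
    simp [scB, scA, Fintype.sum_sum_type]
    rfl
  omega

theorem colSum_scB_alpha : colSum (scB N M k F) (Sum.inr false) = 2 * M := by
  simp [colSum, scB, scA, Fintype.sum_sum_type, two_mul]

theorem colSum_scB_beta : colSum (scB N M k F) (Sum.inr true) = 2 * M - 1 - k := by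
  simp [colSum, scB, scA, Fintype.sum_sum_type]

theorem payoff_scB (hM : 1 ≤ M) (t : SCTeam N M k F) :
    payoff (scB N M k F) t = (scA N M k F t (Sum.inr false) : ℚ) / ((2 * M : ℕ) : ℚ) := by
  rw [payoff_eq_power_of_forall_lt (j := Sum.inr false), power, colSum_scB_alpha]
  · rcases t with i | ⟨j, _⟩ | a | b <;> rfl
  · rintro (j | _ | _) hne
    · rw [colSum_scB_elem hM, colSum_scB_alpha]; omega
    · exact absurd rfl hne
    · rw [colSum_scB_beta, colSum_scB_alpha]; omega

theorem colSum_scB_le (hM : 1 ≤ M) (s : SCSlot N) : colSum (scB N M k F) s ≤ 2 * M := by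
  rcases s with j | _ | _
  · rw [colSum_scB_elem hM]; omega
  · rw [colSum_scB_alpha]
  · rw [colSum_scB_beta]; omega

/-- Some member of an improving coalition is available at `α`. -/
theorem exists_mem_avail_alpha (hM : 1 ≤ M) {S : Finset (SCTeam N M k F)}
    {D : SCTeam N M k F → SCSlot N → ℕ} (hS : S.Nonempty)
    (h : IsImprovement (scA N M k F) (scB N M k F) S D) :
    ∃ t ∈ S, scA N M k F t (Sum.inr false) = 1 := by
  by_contra! hcon
  have h0 : ∀ t ∈ S, scA N M k F t (Sum.inr false) = 0 := fun t ht => by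
    have := hcon t ht
    have := scA_le_one t (Sum.inr false)
    omega
  have hle : ∀ t s, D t s ≤ scB N M k F t s := by
    intro t s
    by_cases ht : t ∈ S
    · have hAB : scA N M k F t s = scB N M k F t s := by
        have := h0 t ht
        rcases t with i | ⟨j, _⟩ | a | b
        · simp [scA] at this
        all_goals rcases s with j' | _ | _ <;> rfl
      exact hAB ▸ h.1 t s
    · exact (h.2.1 t ht s).le
  have hw : (Sum.inr false : SCSlot N) ∈ winners D := by
    rw [mem_winners]
    intro s
    rw [colSum_eq_of_forall_mem_eq_zero isProfile_scB h.1 h.2.1 h0, colSum_scB_alpha]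
    exact (colSum_mono fun t => hle t s).trans (colSum_scB_le hM s)
  obtain ⟨t, ht⟩ := hS
  exact h.avail_ne_zero ht hw (h0 t ht)

/-- The set teams of an improving coalition form a set cover. -/
theorem exists_mem_of_isImprovement (hM : 1 ≤ M) {S : Finset (SCTeam N M k F)}
    {D : SCTeam N M k F → SCSlot N → ℕ} (hS : S.Nonempty)
    (h : IsImprovement (scA N M k F) (scB N M k F) S D) (j : Fin N) :
    ∃ i, Sum.inl i ∈ S ∧ j ∈ F i := by
  by_contra! hcon
  obtain ⟨t, ht, hta⟩ := exists_mem_avail_alpha hM hS h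
  have hte : scA N M k F t (Sum.inl j) = 0 := by
    rcases t with i | ⟨j', _⟩ | a | b
    · simp [scA, hcon i ht]
    · simp [scA] at hta
    · rfl
    · rfl
  obtain ⟨w, hw⟩ := winners_nonempty D
  by_cases hd : ∀ d ∈ S, scA N M k F d (Sum.inl j) = 0
  · have hej := colSum_eq_of_forall_mem_eq_zero isProfile_scB h.1 h.2.1 hd
    rw [colSum_scB_elem hM] at hej
    have hpow := lt_power_of_lt_payoff (h.2.2 t ht) hw
    rw [payoff_scB hM, hta, power] at hpow
    have hwlt : colSum D w < 2 * M := by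
      by_contra! hge
      have hD : (D t w : ℚ) ≤ 1 := by exact_mod_cast (h.1 t w).trans (scA_le_one t w)
      have hge' : ((2 * M : ℕ) : ℚ) ≤ colSum D w := by exact_mod_cast hge
      have hpos : (0 : ℚ) < ((2 * M : ℕ) : ℚ) := by exact_mod_cast (by omega : 0 < 2 * M)
      refine hpow.not_ge ?_
      rw [Nat.cast_one]
      gcongr
    have hjw : (Sum.inl j : SCSlot N) ∈ winners D := by
      rw [mem_winners] at hw ⊢
      intro s
      have := hw s
      omega
    exact h.avail_ne_zero ht hjw hte
  · push Not at hd
    obtain ⟨d, hdS, hdj⟩ := hd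
    have hwj : w = Sum.inl j := by
      have hdw := h.avail_ne_zero hdS hw
      rcases d with i | ⟨j', _⟩ | a | b
      · simp [scA, hcon i hdS] at hdj
      · rcases w with w | _ | _ <;> simp_all [scA]
      · exact absurd rfl hdj
      · exact absurd rfl hdj
    exact h.avail_ne_zero ht hw (hwj ▸ hte)

/-- Set teams in `G` abandon every slot but `β`; all other teams declare as in `scB`. -/
def scMove (N M k : ℕ) (F : Fin M → Finset (Fin N)) (G : Finset (Fin M)) :
    SCTeam N M k F → SCSlot N → ℕ := fun t s =>
  match t, s with
  | Sum.inl i, Sum.inr true => if i ∈ G then 1 else 0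
  | Sum.inl i, s => if i ∈ G then 0 else scB N M k F (Sum.inl i) s
  | t, s => scB N M k F t s

theorem colSum_scMove_beta (hkM : k ≤ M) (hM : 1 ≤ M) {G : Finset (Fin M)} (hG : G.card = k) :
    colSum (scMove N M k F G) (Sum.inr true) = 2 * M - 1 := by
  have hs : colSum (scMove N M k F G) (Sum.inr true) = G.card + (2 * M - 1 - k) := by
    simp [colSum, scMove, scB, scA, Fintype.sum_sum_type]
  omega

theorem colSum_scMove_alpha {G : Finset (Fin M)} :
    colSum (scMove N M k F G) (Sum.inr false) = M - G.card + M := by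
  have h : ∑ i : Fin M, (if i ∈ G then 0 else 1) = M - G.card := by
    have hc := Finset.card_compl G
    rw [Fintype.card_fin] at hc
    simp [← hc, Finset.sum_ite, Finset.filter_notMem_eq_sdiff, Finset.compl_eq_univ_sdiff]
  simp [colSum, scMove, scB, scA, Fintype.sum_sum_type, h]

theorem colSum_scMove_elem_lt {G : Finset (Fin M)} {j : Fin N} (h : ∃ i ∈ G, j ∈ F i) :
    colSum (scMove N M k F G) (Sum.inl j) < colSum (scB N M k F) (Sum.inl j) := by
  obtain ⟨i, hi, hj⟩ := h
  refine Finset.sum_lt_sum (fun t _ => ?_) ⟨Sum.inl i, Finset.mem_univ _, ?_⟩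
  · rcases t with i | t
    · simp only [scMove]; split_ifs <;> omega
    · exact le_rfl
  · simp [scMove, scB, scA, hi, hj]

/-- Moving the set teams of a set cover of size `k` from `α` to `β` is an improvement step. -/
theorem isImprovement_scMove (hk3 : 3 ≤ k) (hkM : k ≤ M) {G : Finset (Fin M)} (hG : G.card = k)
    (hcov : ∀ j, ∃ i ∈ G, j ∈ F i) :
    IsImprovement (scA N M k F) (scB N M k F) (G.map Function.Embedding.inl)
      (scMove N M k F G) := by
  have hM : 1 ≤ M := by omega
  have hβ : colSum (scMove N M k F G) (Sum.inr true) = 2 * M - 1 :=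
    colSum_scMove_beta hkM hM hG
  refine ⟨?_, ?_, ?_⟩
  · rintro (i | t) s
    · rcases s with j | _ | _ <;> simp only [scMove, scB, scA] <;> split_ifs <;> omega
    · exact isProfile_scB (Sum.inr t) s
  · rintro (i | t) ht s
    · have hi : i ∉ G := by simpa using ht
      rcases s with j | _ | _ <;> simp [scMove, scB, hi]
    · rfl
  · intro t ht
    obtain ⟨i, hi, rfl⟩ := Finset.mem_map.1 ht
    rw [payoff_scB hM, payoff_eq_power_of_forall_lt (j := Sum.inr true), power, hβ]
    · have hpos : (0 : ℚ) < ((2 * M - 1 : ℕ) : ℚ) := by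
        exact_mod_cast (by omega : 0 < 2 * M - 1)
      have hlt : ((2 * M - 1 : ℕ) : ℚ) < ((2 * M : ℕ) : ℚ) := by
        exact_mod_cast (by omega : 2 * M - 1 < 2 * M)
      simpa [scA, scMove, hi] using one_div_lt_one_div_of_lt hpos hlt
    · rintro (j | _ | _) hne
      · rw [hβ]
        have hlt := colSum_scMove_elem_lt (k := k) (hcov j)
        rwa [colSum_scB_elem hM] at hlt
      · rw [hβ, colSum_scMove_alpha]
        omega
      · exact absurd rfl hne

end Lemmas

/-- Correctness of the Set Cover reduction (bounded coalition size): some nonempty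
coalition of at most `k` teams has an improvement step with respect to `B` if and
only if there is a set cover of size at most `k`. -/
theorem setcover_reduction_bounded (N M k : ℕ) (hk3 : 3 ≤ k) (hkM : k ≤ M)
    (F : Fin M → Finset (Fin N))
    (hnosmall : ∀ G : Finset (Fin M), G.card < 3 → G.biUnion F ≠ Finset.univ) :
    (∃ (S : Finset (SCTeam N M k F)) (D : SCTeam N M k F → SCSlot N → ℕ),
        S.Nonempty ∧ S.card ≤ k ∧
        IsImprovement (scA N M k F) (scB N M k F) S D) ↔
    ∃ G : Finset (Fin M), G.card ≤ k ∧ G.biUnion F = Finset.univ := by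
  have hM : 1 ≤ M := by omega
  constructor
  · rintro ⟨S, D, hS, hcard, h⟩
    refine ⟨S.preimage Sum.inl Sum.inl_injective.injOn, ?_, ?_⟩
    · exact (Finset.card_le_card_of_injOn Sum.inl (fun i hi => by simpa using hi)
        Sum.inl_injective.injOn).trans hcard
    · ext j
      simpa using exists_mem_of_isImprovement hM hS h j
  · rintro ⟨G, hcard, hcov⟩
    obtain ⟨G', hGG', hG'⟩ := Finset.exists_superset_card_eq hcard (by simpa using hkM)
    refine ⟨G'.map Function.Embedding.inl, scMove N M k F G', ?_, ?_,
      isImprovement_scMove hk3 hkM hG' fun j => ?_⟩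
    · rw [Finset.map_nonempty, ← Finset.card_pos]
      omega
    · rw [Finset.card_map, hG']
    · have hj : j ∈ G.biUnion F := hcov ▸ Finset.mem_univ j
      obtain ⟨i, hi, hij⟩ := Finset.mem_biUnion.1 hj
      exact ⟨i, hGG' hi, hij⟩

end SetCoverReduction
end
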